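/- Let $n$ be an even positive integer and $l$ an even integer with $0\le l<n$. Define $c(\lambda)=2^{\,n+l-\lambda}\dfrac{\Gamma(n)\,\Gamma(\lambda)}{\Gamma\big(\frac{\lambda+n+l}{2}\big)\Gamma\big(\frac{\lambda+n-l}{2}\big)}$ using the complex Gamma function. Then for every $\lambda\in\mathbb{C}\setminus\mathbb{Z}$: $\dfrac{1}{c(\lambda)c(-\lambda)}\;=\;-\pi\,2^{-(4n+2l-3)}\,\Gamma(n)^{-2}\;\lambda^{3}\,\prod_{j=1}^{\frac{n+l}{2}-1}\big(\lambda^{2}-(n+l-2j)^{2}\big)\,\prod_{j=1}^{\frac{n-l}{2}-1}\big(\lambda^{2}-(n-l-2j)^{2}\big)\;\cot\Big(\frac{\pi\lambda}{2}\Big).$ -/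

import Mathlib

open Finset

/-- Reflection formula shifted by a natural number. -/
theorem Complex.Gamma_add_nat_mul_Gamma_neg_add_nat (w : ℂ) (hw : ∀ k : ℤ, w ≠ (k : ℂ)) (m : ℕ) :
    Complex.Gamma (w + (m + 1)) * Complex.Gamma (-w + (m + 1)) =
      (∏ i ∈ Finset.range m, (((i : ℂ) + 1) ^ 2 - w ^ 2)) *
        (Real.pi * w / Complex.sin (Real.pi * w)) := by
  induction m with
  | zero =>
    have h0 : w ≠ 0 := by simpa using hw 0
    have h := Complex.Gamma_mul_Gamma_one_sub w
    have e : -w + 1 = 1 - w := by ring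
    simp only [Nat.cast_zero, zero_add, Finset.range_zero, Finset.prod_empty, one_mul]
    rw [Complex.Gamma_add_one w h0, e, mul_assoc, h]
    ring
  | succ m ih =>
    have h1 : w + (m + 1) ≠ 0 := fun h => hw (-(m + 1)) (by push_cast; linear_combination h)
    have h2 : -w + (m + 1) ≠ 0 := fun h => hw (m + 1) (by push_cast; linear_combination -h)
    have e1 : w + (((m + 1 : ℕ) : ℂ) + 1) = (w + (m + 1)) + 1 := by push_cast; ring
    have e2 : -w + (((m + 1 : ℕ) : ℂ) + 1) = (-w + (m + 1)) + 1 := by push_cast; ring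
    rw [e1, e2, Complex.Gamma_add_one _ h1, Complex.Gamma_add_one _ h2, Finset.prod_range_succ]
    linear_combination (w + (m + 1)) * (-w + (m + 1)) * ih

theorem prod_range_sq_sub_eq_prod_Icc (z : ℂ) (m : ℕ) :
    ∏ i ∈ Finset.range m, (((i : ℂ) + 1) ^ 2 - (z / 2) ^ 2) =
      (-1 / 4) ^ m * ∏ j ∈ Finset.Icc 1 m, (z ^ 2 - (2 * ((m : ℂ) + 1) - 2 * (j : ℂ)) ^ 2) := by
  have hcard : ((-1 / 4 : ℂ)) ^ m = ∏ _j ∈ Finset.Icc 1 m, (-1 / 4 : ℂ) := by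
    rw [Finset.prod_const, Nat.card_Icc, Nat.add_sub_cancel]
  rw [hcard, ← Finset.prod_mul_distrib]
  refine Finset.prod_nbij' (fun i => m - i) (fun j => m - j) ?_ ?_ ?_ ?_ ?_
  · intro i hi; simp only [Finset.mem_range, Finset.mem_Icc] at *; omega
  · intro i hi; simp only [Finset.mem_range, Finset.mem_Icc] at *; omega
  · intro i hi; simp only [Finset.mem_range] at *; omega
  · intro i hi; simp only [Finset.mem_Icc] at *; omega
  · intro i hi
    rw [Nat.cast_sub (Finset.mem_range.mp hi).le]
    ring

theorem Complex.Gamma_mul_Gamma_neg (z : ℂ) (hz : z ≠ 0) :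
    Complex.Gamma z * Complex.Gamma (-z) = -(Real.pi / (z * Complex.sin (Real.pi * z))) := by
  have h := Complex.Gamma_mul_Gamma_one_sub z
  have e : 1 - z = -z + 1 := by ring
  rw [e, Complex.Gamma_add_one _ (neg_ne_zero.mpr hz)] at h
  rw [mul_comm z, ← div_div, ← h]
  field_simp

/-- The case (`n` even, `l` even) of identity (3.12) for the Harish-Chandra
`c`-function of the multiplicity `m₊(l)` on `SU(1,n)`:
`[c(λ)c(-λ)]⁻¹ = γ_{n,l} p_{n,l}(λ) cot(πλ/2)`. -/
theorem stmt18 (n l : ℕ) (hn : Even n) (hnpos : 0 < n) (hl : Even l) (hln : l < n)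
    (c : ℂ → ℂ)
    (hc : ∀ z : ℂ, c z = (2 : ℂ) ^ ((n : ℂ) + (l : ℂ) - z) *
      (Complex.Gamma (n : ℂ) * Complex.Gamma z /
        (Complex.Gamma ((z + (n : ℂ) + (l : ℂ)) / 2) *
          Complex.Gamma ((z + (n : ℂ) - (l : ℂ)) / 2)))) :
    ∀ z : ℂ, (∀ k : ℤ, z ≠ (k : ℂ)) →
      1 / (c z * c (-z)) =
        -(Real.pi : ℂ) * (2 : ℂ) ^ (-(4 * (n : ℤ) + 2 * (l : ℤ) - 3)) *
          (Complex.Gamma (n : ℂ))⁻¹ ^ 2 * z ^ 3 *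
          (∏ j ∈ Finset.Icc 1 ((n + l) / 2 - 1),
            (z ^ 2 - ((n : ℂ) + (l : ℂ) - 2 * (j : ℂ)) ^ 2)) *
          (∏ j ∈ Finset.Icc 1 ((n - l) / 2 - 1),
            (z ^ 2 - ((n : ℂ) - (l : ℂ) - 2 * (j : ℂ)) ^ 2)) *
          Complex.cot ((Real.pi : ℂ) * z / 2) := by
  intro z hz
  obtain ⟨a, rfl⟩ := hn
  obtain ⟨b, rfl⟩ := hl
  obtain ⟨N, rfl⟩ : ∃ N, a = b + N + 1 := ⟨a - b - 1, by omega⟩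
  have i1 : (b + N + 1 + (b + N + 1) + (b + b)) / 2 - 1 = 2 * b + N := by omega
  have i2 : (b + N + 1 + (b + N + 1) - (b + b)) / 2 - 1 = N := by omega
  have hz0 : z ≠ 0 := by simpa using hz 0
  have hw : ∀ k : ℤ, z / 2 ≠ (k : ℂ) := fun k h =>
    hz (2 * k) (by push_cast; linear_combination 2 * h)
  have hpi : (Real.pi : ℂ) ≠ 0 := by exact_mod_cast Real.pi_ne_zero
  have hsin : ∀ w : ℂ, (∀ k : ℤ, w ≠ (k : ℂ)) → Complex.sin (Real.pi * w) ≠ 0 := by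
    intro w hw h
    obtain ⟨k, hk⟩ := Complex.sin_eq_zero_iff.mp h
    exact hw k (mul_left_cancel₀ hpi (by rw [hk]; ring))
  have hs := hsin _ hw
  have hsz := hsin _ hz
  have hdouble : Complex.sin (Real.pi * z) =
      2 * Complex.sin (Real.pi * (z / 2)) * Complex.cos (Real.pi * (z / 2)) := by
    rw [← Complex.sin_two_mul]; congr 1; ring
  have hG : Complex.Gamma ((b + N + 1 + (b + N + 1) : ℕ) : ℂ) ≠ 0 := by
    apply Complex.Gamma_ne_zero_of_re_pos
    rw [Complex.natCast_re]
    exact_mod_cast hnpos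
  have hA := Complex.Gamma_add_nat_mul_Gamma_neg_add_nat (z / 2) hw (2 * b + N)
  have hB := Complex.Gamma_add_nat_mul_Gamma_neg_add_nat (z / 2) hw N
  rw [prod_range_sq_sub_eq_prod_Icc] at hA hB
  have hC := Complex.Gamma_mul_Gamma_neg z hz0
  have hpow : (2 : ℂ) ^ (((b + N + 1 + (b + N + 1) : ℕ) : ℂ) + ((b + b : ℕ) : ℂ) - z) *
      (2 : ℂ) ^ (((b + N + 1 + (b + N + 1) : ℕ) : ℂ) + ((b + b : ℕ) : ℂ) - -z) =
      (2 : ℂ) ^ (8 * b + 4 * N + 4) := by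
    rw [← Complex.cpow_add _ _ two_ne_zero, ← Complex.cpow_natCast]
    congr 1; push_cast; ring
  have hzpow : (2 : ℂ) ^ (-(4 * ((b + N + 1 + (b + N + 1) : ℕ) : ℤ) + 2 * ((b + b : ℕ) : ℤ) - 3)) =
      ((2 : ℂ) ^ (12 * b + 8 * N + 5))⁻¹ := by
    rw [← zpow_natCast, ← zpow_neg]
    congr 1; push_cast; ring
  have hsign : (-1 / 4 : ℂ) ^ (2 * b + N) * (-1 / 4 : ℂ) ^ N = ((2 : ℂ) ^ (4 * b + 4 * N))⁻¹ := by
    rw [← pow_add, show 2 * b + N + N = 2 * (b + N) by ring, pow_mul,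
      show 4 * b + 4 * N = 4 * (b + N) by ring, pow_mul, ← inv_pow]
    norm_num
  have hcot : Complex.cot ((Real.pi : ℂ) * z / 2) =
      Complex.cos (Real.pi * (z / 2)) / Complex.sin (Real.pi * (z / 2)) := by
    rw [Complex.cot, mul_div_assoc]
  have hQ1 : ∏ j ∈ Finset.Icc 1 (2 * b + N), (z ^ 2 - (((b + N + 1 + (b + N + 1) : ℕ) : ℂ) +
      ((b + b : ℕ) : ℂ) - 2 * (j : ℂ)) ^ 2) = ∏ j ∈ Finset.Icc 1 (2 * b + N),
      (z ^ 2 - (2 * (((2 * b + N : ℕ) : ℂ) + 1) - 2 * (j : ℂ)) ^ 2) :=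
    Finset.prod_congr rfl fun j _ => by push_cast; ring
  have hQ2 : ∏ j ∈ Finset.Icc 1 N, (z ^ 2 - (((b + N + 1 + (b + N + 1) : ℕ) : ℂ) -
      ((b + b : ℕ) : ℂ) - 2 * (j : ℂ)) ^ 2) = ∏ j ∈ Finset.Icc 1 N,
      (z ^ 2 - (2 * ((N : ℂ) + 1) - 2 * (j : ℂ)) ^ 2) :=
    Finset.prod_congr rfl fun j _ => by push_cast; ring
  have harg1 : ∀ x : ℂ, (x + ((b + N + 1 + (b + N + 1) : ℕ) : ℂ) + ((b + b : ℕ) : ℂ)) / 2 =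
      x / 2 + (((2 * b + N : ℕ) : ℂ) + 1) := fun x => by push_cast; ring
  have harg2 : ∀ x : ℂ, (x + ((b + N + 1 + (b + N + 1) : ℕ) : ℂ) - ((b + b : ℕ) : ℂ)) / 2 =
      x / 2 + ((N : ℂ) + 1) := fun x => by push_cast; ring
  rw [i1, i2, hQ1, hQ2, hzpow, hcot, hc, hc, harg1, harg1, harg2, harg2, neg_div]
  generalize (∏ j ∈ Finset.Icc 1 (2 * b + N),
      (z ^ 2 - (2 * (((2 * b + N : ℕ) : ℂ) + 1) - 2 * (j : ℂ)) ^ 2)) = Q1 at *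
  generalize (∏ j ∈ Finset.Icc 1 N,
      (z ^ 2 - (2 * ((N : ℂ) + 1) - 2 * (j : ℂ)) ^ 2)) = Q2 at *
  generalize Complex.Gamma ((b + N + 1 + (b + N + 1) : ℕ) : ℂ) = G at *
  have hsplit : ∀ p q g g' u v u' v' : ℂ,
      1 / (p * (G * g / (u * v)) * (q * (G * g' / (u' * v')))) =
        (u * u') * (v * v') / ((p * q) * G ^ 2 * (g * g')) := by
    intro p q g g' u v u' v'
    simp only [div_eq_mul_inv, mul_inv, inv_inv, one_mul]
    ring
  rw [hsplit, hA, hB, hC, hpow]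
  have hc0 : Complex.cos (Real.pi * (z / 2)) ≠ 0 := fun h => hsz (by rw [hdouble, h, mul_zero])
  rw [hdouble]
  generalize Complex.sin (Real.pi * (z / 2)) = S at *
  generalize Complex.cos (Real.pi * (z / 2)) = C at *
  have hcombine : ∀ r t X : ℂ, r * Q1 * X * (t * Q2 * X) = (r * t) * (Q1 * Q2 * X ^ 2) :=
    fun r t X => by ring
  rw [hcombine, hsign]
  field_simp
  ring
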